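/- Fix β = 1.02 and K = √(2πe). Let σ_s > 0, Δ > 0, and T > 1 be real numbers, and let n be a real number with n ≥ (4β²σ_s²/Δ²)·(1 + 2·log T − log 2 − log log T). Then for every real t ∈ [1, T] and every q ∈ ℝ with Φ(q) = 1 − 1/(K·t), one has 2·σ_s·q/√(n) ≤ Δ. (For T > 1, the quantity 1 + 2·log T − log 2 − log log T is strictly positive, so n > 0.) -/

import Mathlib

open Real MeasureTheory

/-- The cumulative distribution function of the standard Gaussian distribution. -/
noncomputable def Phi (x : ℝ) : ℝ :=
  (Real.sqrt (2 * Real.pi))⁻¹ * ∫ u in Set.Iic x, Real.exp (-u ^ 2 / 2)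

theorem integrable_exp_neg_sq_div_two : Integrable fun u : ℝ => Real.exp (-u ^ 2 / 2) := by
  refine (integrable_exp_neg_mul_sq (b := 1 / 2) (by norm_num)).congr (.of_forall fun u => ?_)
  simp only
  congr 1
  ring

/-- Gaussian Mills-ratio bound, without normalisation. -/
theorem integral_Ioi_exp_neg_sq_div_two_le {q : ℝ} (hq : 0 < q) :
    ∫ u in Set.Ioi q, Real.exp (-u ^ 2 / 2) ≤ Real.exp (-q ^ 2 / 2) / q := by
  have hint : Integrable fun u : ℝ => u * Real.exp (-u ^ 2 / 2) := by
    refine (integrable_mul_exp_neg_mul_sq (b := 1 / 2) (by norm_num)).congr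
      (.of_forall fun u => ?_)
    simp only
    congr 2
    ring
  have hderiv : ∀ u ∈ Set.Ici q,
      HasDerivAt (fun u : ℝ => -Real.exp (-u ^ 2 / 2)) (u * Real.exp (-u ^ 2 / 2)) u := by
    intro u _
    have h := ((((hasDerivAt_id u).pow 2).neg.div_const 2).exp).neg
    refine h.congr_deriv ?_
    simp
    ring
  have hlim : Filter.Tendsto (fun u : ℝ => -Real.exp (-u ^ 2 / 2)) Filter.atTop (nhds 0) := by
    rw [← neg_zero]
    refine (Real.tendsto_exp_atBot.comp ?_).neg
    have h : Filter.Tendsto (fun u : ℝ => u ^ 2 / 2) Filter.atTop Filter.atTop :=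
      (Filter.tendsto_pow_atTop two_ne_zero).atTop_div_const two_pos
    refine (Filter.tendsto_neg_atTop_atBot.comp h).congr fun u => ?_
    simp only [Function.comp]
    ring
  have hval := integral_Ioi_of_hasDerivAt_of_tendsto' hderiv hint.integrableOn hlim
  rw [le_div_iff₀ hq, mul_comm, ← integral_const_mul]
  calc ∫ u in Set.Ioi q, q * Real.exp (-u ^ 2 / 2)
      ≤ ∫ u in Set.Ioi q, u * Real.exp (-u ^ 2 / 2) := by
        refine setIntegral_mono_on (integrable_exp_neg_sq_div_two.const_mul q).integrableOn
          hint.integrableOn measurableSet_Ioi fun u hu => ?_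
        exact mul_le_mul_of_nonneg_right (le_of_lt hu) (Real.exp_pos _).le
    _ = Real.exp (-q ^ 2 / 2) := by rw [hval]; ring

theorem one_sub_Phi (q : ℝ) :
    1 - Phi q = (√(2 * π))⁻¹ * ∫ u in Set.Ioi q, Real.exp (-u ^ 2 / 2) := by
  have htotal : ∫ u : ℝ, Real.exp (-u ^ 2 / 2) = √(2 * π) := by
    have h := integral_gaussian (1 / 2)
    rw [show π / (1 / 2) = 2 * π by ring] at h
    rw [← h]
    congr 1 with u
    congr 1
    ring
  have hsplit := integral_add_compl (measurableSet_Iic (a := q)) integrable_exp_neg_sq_div_two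
  rw [Set.compl_Iic, htotal] at hsplit
  have hpos : √(2 * π) ≠ 0 := by positivity
  rw [Phi, eq_sub_of_add_eq hsplit]
  field_simp
  ring

theorem one_sub_Phi_le {q : ℝ} (hq : 0 < q) :
    1 - Phi q ≤ (√(2 * π))⁻¹ * (Real.exp (-q ^ 2 / 2) / q) := by
  rw [one_sub_Phi]
  exact mul_le_mul_of_nonneg_left (integral_Ioi_exp_neg_sq_div_two_le hq) (by positivity)

theorem le_mul_exp_one_add_sub_log {y : ℝ} (hy : 0 < y) :
    y ≤ (1.02 : ℝ) ^ 2 * (1 + y - Real.log y) *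
      Real.exp (((1.02 : ℝ) ^ 2 - 1) * (1 + y - Real.log y)) := by
  have he := Real.exp_one_gt_d9
  have hs2 : 2 ≤ 1 + y - Real.log y := by linarith [Real.log_le_sub_one_of_pos hy]
  have hexp := Real.quadratic_le_exp_of_nonneg
    (x := ((1.02 : ℝ) ^ 2 - 1) * (1 + y - Real.log y)) (by norm_num; linarith)
  set s := 1 + y - Real.log y with hs
  rcases le_or_gt y (Real.exp 1) with hye | hye
  · have hlog : Real.log y ≤ 1 := (Real.log_le_iff_le_exp hy).2 hye
    have h1 : 1 ≤ Real.exp (((1.02 : ℝ) ^ 2 - 1) * s) := by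
      apply Real.one_le_exp
      norm_num
      linarith
    nlinarith
  · have hlog1 : Real.log y ≤ y / Real.exp 1 := by
      have h := Real.log_le_sub_one_of_pos (div_pos hy (Real.exp_pos 1))
      rw [Real.log_div hy.ne' (Real.exp_pos 1).ne', Real.log_exp] at h
      linarith
    have hlog2 : Real.log y ≤ 1 + y / Real.exp 2 := by
      have h := Real.log_le_sub_one_of_pos (div_pos hy (Real.exp_pos 2))
      rw [Real.log_div hy.ne' (Real.exp_pos 2).ne', Real.log_exp] at h
      linarith
    have hexp2 : (7.389 : ℝ) ≤ Real.exp 2 := by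
      rw [show (2 : ℝ) = 1 + 1 by norm_num, Real.exp_add]
      nlinarith
    have hb1 : y / Real.exp 1 ≤ y / 2.718 := by gcongr; linarith
    have hb2 : y / Real.exp 2 ≤ y / 7.389 := by gcongr
    have hslin : 0.8646 * y ≤ s := by
      have : y / 7.389 ≤ 0.1354 * y := by
        rw [div_le_iff₀ (by norm_num)]; nlinarith
      linarith
    have hsge : 2.717 ≤ s := by
      have : y / 2.718 ≤ 0.368 * y := by
        rw [div_le_iff₀ (by norm_num)]; nlinarith
      linarith
    have hE : 1.1157 ≤ Real.exp (((1.02 : ℝ) ^ 2 - 1) * s) := by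
      refine le_trans ?_ hexp
      nlinarith
    nlinarith

/-- Upper bound on the Gaussian quantile at level `1 - 1 / (√(2πe) t)`, uniform in `t ≤ T`. -/
theorem sq_le_of_Phi_eq {T t q : ℝ} (hT : 1 < T) (ht : t ∈ Set.Icc 1 T) (hq : 0 < q)
    (h : Phi q = 1 - 1 / (√(2 * π * Real.exp 1) * t)) :
    q ^ 2 ≤ (1.02 : ℝ) ^ 2 *
      (1 + 2 * Real.log T - Real.log 2 - Real.log (Real.log T)) := by
  have hT0 : 0 < T := by linarith
  have hL : 0 < Real.log T := Real.log_pos hT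
  have ht0 : 0 < t := by linarith [ht.1]
  set y := 2 * Real.log T with hy
  have hy0 : 0 < y := by positivity
  have hlog : 1 + y - Real.log 2 - Real.log (Real.log T) = 1 + y - Real.log y := by
    rw [hy, Real.log_mul two_ne_zero hL.ne']
    ring
  rw [hlog]
  have hkey := le_mul_exp_one_add_sub_log hy0
  have hs0 : 0 < 1 + y - Real.log y := by linarith [Real.log_le_sub_one_of_pos hy0]
  set s := 1 + y - Real.log y with hs
  have hmills : 1 / (√(2 * π * Real.exp 1) * t) ≤
      (√(2 * π))⁻¹ * (Real.exp (-q ^ 2 / 2) / q) := by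
    have := one_sub_Phi_le hq
    rw [h] at this
    linarith
  have hq_le : q * Real.exp (q ^ 2 / 2) ≤ √(Real.exp 1) * T := by
    rw [Real.sqrt_mul (by positivity), neg_div, Real.exp_neg] at hmills
    have hK : 0 < √(2 * π) := by positivity
    have he : 0 < √(Real.exp 1) := by positivity
    have heq : (√(2 * π))⁻¹ * ((Real.exp (q ^ 2 / 2))⁻¹ / q) =
        1 / (√(2 * π) * (q * Real.exp (q ^ 2 / 2))) := by
      field_simp
    rw [heq, one_div_le_one_div (by positivity) (by positivity), mul_assoc] at hmills
    exact (le_of_mul_le_mul_left hmills hK).trans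
      (mul_le_mul_of_nonneg_left ht.2 he.le)
  have hsq : q ^ 2 * Real.exp (q ^ 2) ≤ Real.exp (1 + y) := by
    have h2 := pow_le_pow_left₀ (by positivity) hq_le 2
    rw [mul_pow, mul_pow, Real.sq_sqrt (Real.exp_pos 1).le, ← Real.exp_nat_mul] at h2
    have hTy : Real.exp y = T ^ 2 := by
      rw [hy, two_mul, Real.exp_add, Real.exp_log hT0, sq]
    rw [Real.exp_add, hTy]
    rwa [show ((2 : ℕ) : ℝ) * (q ^ 2 / 2) = q ^ 2 by push_cast; ring] at h2
  by_contra! hlt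
  have hlt2 : (1.02 : ℝ) ^ 2 * s * Real.exp ((1.02 : ℝ) ^ 2 * s) < q ^ 2 * Real.exp (q ^ 2) :=
    mul_lt_mul'' hlt (Real.exp_lt_exp.2 hlt) (by positivity) (by positivity)
  have hexp : Real.exp (1 + y) = y * Real.exp s := by
    rw [show 1 + y = Real.log y + s by rw [hs]; ring, Real.exp_add, Real.exp_log hy0]
  have hsplit : Real.exp ((1.02 : ℝ) ^ 2 * s) =
      Real.exp (((1.02 : ℝ) ^ 2 - 1) * s) * Real.exp s := by
    rw [← Real.exp_add]
    congr 1
    ring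
  have hle := mul_le_mul_of_nonneg_right hkey (Real.exp_pos s).le
  rw [← hexp, mul_assoc _ (Real.exp _), ← hsplit] at hle
  linarith

theorem ucl_exploration_bound (σs Δ T n : ℝ) (hσ : 0 < σs) (hΔ : 0 < Δ)
    (hT : 1 < T)
    (hn : 4 * (1.02 : ℝ) ^ 2 * σs ^ 2 / Δ ^ 2 *
      (1 + 2 * Real.log T - Real.log 2 - Real.log (Real.log T)) ≤ n) :
    ∀ t ∈ Set.Icc (1 : ℝ) T, ∀ q : ℝ,
      Phi q = 1 - 1 / (Real.sqrt (2 * Real.pi * Real.exp 1) * t) →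
      2 * σs * q / Real.sqrt n ≤ Δ := by
  intro t ht q h
  rcases le_or_gt q 0 with hq | hq
  · refine le_trans (div_nonpos_of_nonpos_of_nonneg ?_ (Real.sqrt_nonneg n)) hΔ.le
    exact mul_nonpos_of_nonneg_of_nonpos (by positivity) hq
  have hq2 := sq_le_of_Phi_eq hT ht hq h
  have hle : (2 * σs * q / Δ) ^ 2 ≤ n := by
    refine le_trans ?_ hn
    have h1 := mul_le_mul_of_nonneg_left hq2 (a := 4 * σs ^ 2 / Δ ^ 2) (by positivity)
    calc (2 * σs * q / Δ) ^ 2 = 4 * σs ^ 2 / Δ ^ 2 * q ^ 2 := by ring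
      _ ≤ _ := h1
      _ = _ := by ring
  have hsqrt : 2 * σs * q / Δ ≤ √n := Real.le_sqrt_of_sq_le hle
  have hpos : 0 < √n := lt_of_lt_of_le (by positivity) hsqrt
  rw [div_le_iff₀ hΔ] at hsqrt
  rw [div_le_iff₀ hpos]
  linarith
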